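/- For every partition λ of n, there exists a bijection between the product of the set of standard Young tableaux of shape λ with the set {1, 2, …, n+1}, and the disjoint union, over all partitions μ of n+1 obtained from λ by adding one square, of the sets of standard Young tableaux of shape μ. -/

import Mathlib

/-- A standard Young tableau of shape `μ`, encoded as a function on cells
(`0` outside the diagram) which is a bijection from the cells of `μ` onto
`{1, …, μ.card}` and strictly increases along rows and along columns. -/
def IsSYT (μ : YoungDiagram) (T : ℕ × ℕ → ℕ) : Prop :=
  Set.BijOn T (μ.cells : Set (ℕ × ℕ)) (Set.Icc 1 μ.card) ∧
  (∀ i j1 j2 : ℕ, j1 < j2 → (i, j2) ∈ μ → T (i, j1) < T (i, j2)) ∧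
  (∀ i1 i2 j : ℕ, i1 < i2 → (i2, j) ∈ μ → T (i1, j) < T (i2, j)) ∧
  (∀ c : ℕ × ℕ, c ∉ μ → T c = 0)

/-- `f_μ`, the number of standard Young tableaux of shape `μ`. -/
noncomputable def sytCard (μ : YoungDiagram) : ℕ :=
  Nat.card {T : ℕ × ℕ → ℕ // IsSYT μ T}


namespace YoungDiagram

theorem card_le_card_of_le {k l : YoungDiagram} (h : k ≤ l) : k.card ≤ l.card :=
  Finset.card_le_card (cells_subset_iff.2 h)

theorem eq_of_le_of_card_le {k l : YoungDiagram} (h : k ≤ l) (hc : l.card ≤ k.card) : k = l :=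
  YoungDiagram.ext (Finset.eq_of_subset_of_card_le (cells_subset_iff.2 h) hc)

theorem card_sup_add_card_inf (k l : YoungDiagram) :
    (k ⊔ l).card + (k ⊓ l).card = k.card + l.card := by
  simp only [YoungDiagram.card, cells_sup, cells_inf]
  exact Finset.card_union_add_card_inter _ _

theorem fst_lt_card {l : YoungDiagram} {i j : ℕ} (h : (i, j) ∈ l) : i < l.card := by
  have hs : (Finset.range (i + 1)).image (fun a => (a, j)) ⊆ l.cells := by
    intro c hc
    obtain ⟨a, ha, rfl⟩ := Finset.mem_image.1 hc
    exact l.up_left_mem (Nat.lt_succ_iff.1 (Finset.mem_range.1 ha)) le_rfl h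
  have := Finset.card_le_card hs
  rw [Finset.card_image_of_injective _ (fun a b hab => (Prod.ext_iff.1 hab).1),
    Finset.card_range] at this
  exact this

theorem snd_lt_card {l : YoungDiagram} {i j : ℕ} (h : (i, j) ∈ l) : j < l.card := by
  have hs : (Finset.range (j + 1)).image (fun a => (i, a)) ⊆ l.cells := by
    intro c hc
    obtain ⟨a, ha, rfl⟩ := Finset.mem_image.1 hc
    exact l.up_left_mem le_rfl (Nat.lt_succ_iff.1 (Finset.mem_range.1 ha)) h
  have := Finset.card_le_card hs
  rw [Finset.card_image_of_injective _ (fun a b hab => (Prod.ext_iff.1 hab).2),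
    Finset.card_range] at this
  exact this

theorem finite_setOf_card_eq (n : ℕ) : {l : YoungDiagram | l.card = n}.Finite := by
  refine Set.Finite.of_finite_image (f := YoungDiagram.cells)
    ((Finset.finite_toSet (Finset.range n ×ˢ Finset.range n).powerset).subset ?_)
    (fun a _ b _ h => YoungDiagram.ext h)
  rintro _ ⟨l, rfl, rfl⟩
  simp only [Finset.coe_powerset, Set.mem_preimage, Set.mem_powerset_iff, Finset.coe_subset]
  rintro ⟨i, j⟩ h
  simp only [Finset.mem_product, Finset.mem_range]
  exact ⟨fst_lt_card h, snd_lt_card h⟩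

/-- The diagrams obtained from `l` by adding one cell. -/
noncomputable def upCovers (l : YoungDiagram) : Finset YoungDiagram :=
  ((finite_setOf_card_eq (l.card + 1)).subset
    (fun _ h => h.2 : {m | l ≤ m ∧ m.card = l.card + 1} ⊆ _)).toFinset

/-- The diagrams obtained from `l` by removing one cell. -/
noncomputable def downCovers (l : YoungDiagram) : Finset YoungDiagram :=
  ((finite_setOf_card_eq (l.card - 1)).subset
    (fun _ h => Nat.eq_sub_of_add_eq h.2 :
      {k : YoungDiagram | k ≤ l ∧ k.card + 1 = l.card} ⊆ _)).toFinset

theorem mem_upCovers {l m : YoungDiagram} : m ∈ l.upCovers ↔ l ≤ m ∧ m.card = l.card + 1 := by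
  simp [upCovers]

theorem mem_downCovers {k l : YoungDiagram} :
    k ∈ l.downCovers ↔ k ≤ l ∧ k.card + 1 = l.card := by
  simp [downCovers]

theorem mem_downCovers_iff_mem_upCovers {k l : YoungDiagram} :
    k ∈ l.downCovers ↔ l ∈ k.upCovers := by
  rw [mem_upCovers, mem_downCovers, eq_comm]

open Classical in
/-- Two distinct diagrams of the same size have a common upper cover if and only if they have a
common lower cover, and both are then unique. -/
theorem card_common_upCovers_eq {l v : YoungDiagram} (hne : l ≠ v) :
    (l.upCovers.filter (· ∈ v.upCovers)).card = (l.downCovers.filter (· ∈ v.downCovers)).card := by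
  have key := card_sup_add_card_inf l v
  by_cases hc : l.card = v.card ∧ (l ⊔ v).card = l.card + 1
  · have hup : l.upCovers.filter (· ∈ v.upCovers) = {l ⊔ v} := by
      ext m
      simp only [Finset.mem_filter, mem_upCovers, Finset.mem_singleton]
      constructor
      · rintro ⟨⟨h1, h2⟩, h3, h4⟩
        exact (eq_of_le_of_card_le (sup_le h1 h3) (by omega)).symm
      · rintro rfl
        exact ⟨⟨le_sup_left, by omega⟩, le_sup_right, by omega⟩
    have hdown : l.downCovers.filter (· ∈ v.downCovers) = {l ⊓ v} := by
      ext m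
      simp only [Finset.mem_filter, mem_downCovers, Finset.mem_singleton]
      constructor
      · rintro ⟨⟨h1, h2⟩, h3, h4⟩
        exact eq_of_le_of_card_le (le_inf h1 h3) (by omega)
      · rintro rfl
        exact ⟨⟨inf_le_left, by omega⟩, inf_le_right, by omega⟩
    rw [hup, hdown, Finset.card_singleton, Finset.card_singleton]
  · have hlt (h : l.card = v.card) : l.card < (l ⊔ v).card := by
      by_contra! hle
      have h1 := eq_of_le_of_card_le (le_sup_left : l ≤ l ⊔ v) hle
      have h2 := eq_of_le_of_card_le (le_sup_right : v ≤ l ⊔ v) (h ▸ hle)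
      exact hne (h1.trans h2.symm)
    have hup : l.upCovers.filter (· ∈ v.upCovers) = ∅ := by
      rw [Finset.filter_eq_empty_iff]
      intro m h1 h2
      rw [mem_upCovers] at h1 h2
      have := card_le_card_of_le (sup_le h1.1 h2.1)
      have := hlt (by omega)
      exact hc ⟨by omega, by omega⟩
    have hdown : l.downCovers.filter (· ∈ v.downCovers) = ∅ := by
      rw [Finset.filter_eq_empty_iff]
      intro m h1 h2
      rw [mem_downCovers] at h1 h2
      have := card_le_card_of_le (le_inf h1.1 h2.1)
      have := hlt (by omega)
      exact hc ⟨by omega, by omega⟩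
    rw [hup, hdown]

/-- The rows of `l` at whose end a cell can be added. -/
def addableRows (l : YoungDiagram) : Finset ℕ :=
  (Finset.range (l.card + 1)).filter fun i => i = 0 ∨ l.rowLen i < l.rowLen (i - 1)

/-- The rows of `l` whose last cell can be removed. -/
def removableRows (l : YoungDiagram) : Finset ℕ :=
  (Finset.range l.card).filter fun i => l.rowLen (i + 1) < l.rowLen i

theorem mem_addableRows {l : YoungDiagram} {i : ℕ} :
    i ∈ l.addableRows ↔ i = 0 ∨ l.rowLen i < l.rowLen (i - 1) := by
  simp only [addableRows, Finset.mem_filter, Finset.mem_range, and_iff_right_iff_imp]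
  rintro (rfl | h)
  · omega
  · have := fst_lt_card (mem_iff_lt_rowLen.2 h)
    omega

theorem mem_removableRows {l : YoungDiagram} {i : ℕ} :
    i ∈ l.removableRows ↔ l.rowLen (i + 1) < l.rowLen i := by
  simp only [removableRows, Finset.mem_filter, Finset.mem_range, and_iff_right_iff_imp]
  exact fun h => fst_lt_card (mem_iff_lt_rowLen.2 h)

theorem card_addableRows (l : YoungDiagram) :
    l.addableRows.card = l.removableRows.card + 1 := by
  have h : l.addableRows = insert 0 (l.removableRows.image Nat.succ) := by
    ext i
    rcases i with _ | i <;> simp [mem_addableRows, mem_removableRows]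
  rw [h, Finset.card_insert_of_notMem (by simp),
    Finset.card_image_of_injective _ Nat.succ_injective]

/-- Add a cell at the end of an addable row. -/
def addCell (l : YoungDiagram) (i : ℕ) (hi : i ∈ l.addableRows) : YoungDiagram where
  cells := insert (i, l.rowLen i) l.cells
  isLowerSet := by
    rintro ⟨a, b⟩ ⟨c, d⟩ hle h
    obtain ⟨h1, h2⟩ : c ≤ a ∧ d ≤ b := hle
    simp only [Finset.coe_insert, Set.mem_insert_iff, Prod.mk.injEq, Finset.mem_coe, mem_cells,
      mem_iff_lt_rowLen] at h ⊢
    rw [mem_addableRows] at hi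
    rcases h with ⟨rfl, rfl⟩ | h
    · rcases Nat.lt_or_ge c a with hca | hca
      · have := l.rowLen_anti c (a - 1) (by omega)
        omega
      · obtain rfl : c = a := by omega
        omega
    · have := l.rowLen_anti c a h1
      omega

/-- Remove the last cell of a removable row. -/
def removeCell (l : YoungDiagram) (i : ℕ) (hi : i ∈ l.removableRows) : YoungDiagram where
  cells := l.cells.erase (i, l.rowLen i - 1)
  isLowerSet := by
    rintro ⟨a, b⟩ ⟨c, d⟩ hle h
    obtain ⟨h1, h2⟩ : c ≤ a ∧ d ≤ b := hle
    simp only [Finset.coe_erase, Set.mem_sdiff, Set.mem_singleton_iff, Prod.mk.injEq,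
      Finset.mem_coe, mem_cells, mem_iff_lt_rowLen] at h ⊢
    rw [mem_removableRows] at hi
    have := l.rowLen_anti c a h1
    refine ⟨by omega, ?_⟩
    rintro ⟨rfl, rfl⟩
    rcases Nat.lt_or_ge c a with hca | hca
    · have := l.rowLen_anti (c + 1) a hca
      omega
    · obtain rfl : c = a := by omega
      omega

theorem exists_cells_eq_insert {k l : YoungDiagram} (h : l ∈ k.upCovers) :
    ∃ c ∉ k.cells, l.cells = insert c k.cells := by
  rw [mem_upCovers] at h
  have hs := cells_subset_iff.2 h.1
  have hc : (l.cells \ k.cells).card = 1 := by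
    rw [Finset.card_sdiff_of_subset hs]
    have : l.cells.card = k.cells.card + 1 := h.2
    omega
  obtain ⟨c, hc⟩ := Finset.card_eq_one.1 hc
  have hm : c ∈ l.cells \ k.cells := by simp [hc]
  refine ⟨c, (Finset.mem_sdiff.1 hm).2, ?_⟩
  rw [Finset.insert_eq, ← hc, Finset.sdiff_union_of_subset hs]

theorem card_upCovers_eq_card_addableRows (l : YoungDiagram) :
    l.upCovers.card = l.addableRows.card := by
  symm
  refine Finset.card_bij (fun i hi => l.addCell i hi) ?_ ?_ ?_
  · intro i hi
    rw [mem_upCovers, ← cells_subset_iff]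
    refine ⟨Finset.subset_insert _ _, Finset.card_insert_of_notMem ?_⟩
    simp [mem_iff_lt_rowLen]
  · intro i hi a ha h
    have h1 : (i, l.rowLen i) ∈ (l.addCell a ha).cells := by
      rw [← h]
      exact Finset.mem_insert_self _ _
    simp only [addCell, Finset.mem_insert, Prod.mk.injEq, mem_cells, mem_iff_lt_rowLen] at h1
    omega
  · intro m hm
    obtain ⟨⟨i, j⟩, hc, hm⟩ := exists_cells_eq_insert hm
    have hmem (a b : ℕ) : (a, b) ∈ m ↔ (a = i ∧ b = j) ∨ b < l.rowLen a := by
      rw [← mem_cells, hm, Finset.mem_insert, Prod.mk.injEq, mem_cells, mem_iff_lt_rowLen]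
    rw [mem_cells, mem_iff_lt_rowLen] at hc
    have hin : (i, j) ∈ m := (hmem _ _).2 (Or.inl ⟨rfl, rfl⟩)
    have hj : j = l.rowLen i := by
      by_contra hne
      have := (hmem _ _).1 (m.up_left_mem (le_refl i) (show l.rowLen i ≤ j by omega) hin)
      omega
    subst hj
    refine ⟨i, mem_addableRows.2 ?_, YoungDiagram.ext hm.symm⟩
    by_contra! h
    have := (hmem _ _).1 (m.up_left_mem (show i - 1 ≤ i by omega) le_rfl hin)
    omega

theorem card_downCovers_eq_card_removableRows (l : YoungDiagram) :
    l.downCovers.card = l.removableRows.card := by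
  symm
  refine Finset.card_bij (fun i hi => l.removeCell i hi) ?_ ?_ ?_
  · intro i hi
    rw [mem_downCovers, ← cells_subset_iff]
    refine ⟨Finset.erase_subset _ _, Finset.card_erase_add_one ?_⟩
    rw [mem_removableRows] at hi
    rw [mem_cells, mem_iff_lt_rowLen]
    omega
  · intro i hi a ha h
    have h1 : (i, l.rowLen i - 1) ∉ (l.removeCell a ha).cells := by
      rw [← h]
      exact Finset.notMem_erase _ _
    simp only [removeCell, Finset.mem_erase, ne_eq, Prod.mk.injEq, mem_cells,
      mem_iff_lt_rowLen] at h1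
    rw [mem_removableRows] at hi
    omega
  · intro k hk
    obtain ⟨⟨i, j⟩, hc, hk⟩ := exists_cells_eq_insert (mem_downCovers_iff_mem_upCovers.1 hk)
    have hmem (a b : ℕ) : b < l.rowLen a ↔ (a = i ∧ b = j) ∨ (a, b) ∈ k := by
      rw [← mem_iff_lt_rowLen, ← mem_cells, hk, Finset.mem_insert, Prod.mk.injEq, mem_cells]
    rw [mem_cells] at hc
    have hin : j < l.rowLen i := (hmem _ _).2 (Or.inl ⟨rfl, rfl⟩)
    have hj : j = l.rowLen i - 1 := by
      by_contra hne
      rcases (hmem i (j + 1)).1 (by omega) with h | h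
      · omega
      · exact hc (k.up_left_mem le_rfl (Nat.le_succ j) h)
    refine ⟨i, mem_removableRows.2 ?_, YoungDiagram.ext ?_⟩
    · by_contra! h
      rcases (hmem (i + 1) j).1 (by omega) with h | h
      · omega
      · exact hc (k.up_left_mem (Nat.le_succ i) le_rfl h)
    · change l.cells.erase (i, l.rowLen i - 1) = k.cells
      rw [← hj, hk, Finset.erase_insert (by simpa using hc)]

theorem card_upCovers (l : YoungDiagram) : l.upCovers.card = l.downCovers.card + 1 := by
  rw [card_upCovers_eq_card_addableRows, card_downCovers_eq_card_removableRows, card_addableRows]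

/-- The commutation relation `D U - U D = 1` on Young's lattice. -/
theorem sum_upCovers_sum_downCovers (f : YoungDiagram → ℕ) (l : YoungDiagram) :
    ∑ m ∈ l.upCovers, ∑ v ∈ m.downCovers, f v =
      f l + ∑ k ∈ l.downCovers, ∑ v ∈ k.upCovers, f v := by
  classical
  set P := (finite_setOf_card_eq l.card).toFinset with hP
  have hmemP (v : YoungDiagram) : v ∈ P ↔ v.card = l.card := by simp [hP]
  have h1 : ∑ m ∈ l.upCovers, ∑ v ∈ m.downCovers, f v =
      ∑ v ∈ P, (l.upCovers.filter (· ∈ v.upCovers)).card * f v := by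
    rw [Finset.sum_comm' (t' := P) (s' := fun v => l.upCovers.filter (· ∈ v.upCovers))]
    · simp
    · intro m v
      simp only [Finset.mem_filter, hmemP, mem_upCovers, mem_downCovers]
      constructor
      · rintro ⟨⟨h1, h2⟩, h3, h4⟩
        exact ⟨⟨⟨h1, h2⟩, h3, by omega⟩, by omega⟩
      · rintro ⟨⟨⟨h1, h2⟩, h3, h4⟩, h5⟩
        exact ⟨⟨h1, h2⟩, h3, by omega⟩
  have h2 : ∑ k ∈ l.downCovers, ∑ v ∈ k.upCovers, f v =
      ∑ v ∈ P, (l.downCovers.filter (· ∈ v.downCovers)).card * f v := by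
    rw [Finset.sum_comm' (t' := P) (s' := fun v => l.downCovers.filter (· ∈ v.downCovers))]
    · simp
    · intro m v
      simp only [Finset.mem_filter, hmemP, mem_upCovers, mem_downCovers]
      constructor
      · rintro ⟨⟨h1, h2⟩, h3, h4⟩
        exact ⟨⟨⟨h1, h2⟩, h3, by omega⟩, by omega⟩
      · rintro ⟨⟨⟨h1, h2⟩, h3, h4⟩, h5⟩
        exact ⟨⟨h1, h2⟩, h3, by omega⟩
  have hl : l ∈ P := (hmemP l).2 rfl
  rw [h1, h2, ← Finset.add_sum_erase P _ hl, ← Finset.add_sum_erase P _ hl,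
    Finset.sum_congr rfl (fun v hv => by
      rw [card_common_upCovers_eq (Finset.ne_of_mem_erase hv).symm])]
  simp only [Finset.filter_mem_eq_inter, Finset.inter_self, card_upCovers]
  ring

end YoungDiagram

open YoungDiagram

namespace IsSYT

theorem mem_iff_pos {l : YoungDiagram} {T : ℕ × ℕ → ℕ} (hT : IsSYT l T) (c : ℕ × ℕ) :
    c ∈ l ↔ 0 < T c := by
  constructor
  · exact fun h => (hT.1.1 h).1
  · intro h
    by_contra hc
    exact h.ne' (hT.2.2.2 c hc)

theorem le_card {l : YoungDiagram} {T : ℕ × ℕ → ℕ} (hT : IsSYT l T) (c : ℕ × ℕ) :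
    T c ≤ l.card := by
  by_cases h : c ∈ l
  · exact (hT.1.1 h).2
  · rw [hT.2.2.2 c h]
    exact Nat.zero_le _

/-- Extend a tableau by placing the next entry in the new cell. -/
theorem update {k l : YoungDiagram} {T : ℕ × ℕ → ℕ} (hT : IsSYT k T) {c : ℕ × ℕ}
    (hc : c ∉ k.cells) (hl : l.cells = insert c k.cells) :
    IsSYT l (Function.update T c (k.card + 1)) := by
  have hcard : l.card = k.card + 1 := by
    rw [YoungDiagram.card, hl, Finset.card_insert_of_notMem hc]
  have hmem (d : ℕ × ℕ) : d ∈ l ↔ d = c ∨ d ∈ k := by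
    rw [← mem_cells, hl, Finset.mem_insert, mem_cells]
  rw [mem_cells] at hc
  have hlt (d e : ℕ × ℕ) (hde : d ≤ e) (hne : d ≠ e) (he : e ∈ l) (h : e ∈ k → T d < T e) :
      Function.update T c (k.card + 1) d < Function.update T c (k.card + 1) e := by
    rcases (hmem e).1 he with rfl | hek
    · rw [Function.update_self, Function.update_of_ne hne]
      exact Nat.lt_succ_of_le (hT.le_card d)
    · have hdc : d ≠ c := by
        rintro rfl
        exact hc (k.isLowerSet hde hek)
      have hec : e ≠ c := by
        rintro rfl
        exact hc hek
      rw [Function.update_of_ne hdc, Function.update_of_ne hec]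
      exact h hek
  refine ⟨⟨?_, ?_, ?_⟩, ?_, ?_, ?_⟩
  · intro d hd
    by_cases h : d = c
    · subst h
      simp [hcard]
    · have hk := ((hmem d).1 hd).resolve_left h
      rw [Function.update_of_ne h, hcard]
      exact ⟨(hT.1.1 hk).1, (hT.le_card d).trans (Nat.le_succ _)⟩
  · intro d hd e he hde
    have hd' := (hmem d).1 hd
    have he' := (hmem e).1 he
    have h1 := hT.le_card d
    have h2 := hT.le_card e
    by_cases h : d = c <;> by_cases h' : e = c
    · rw [h, h']
    · rw [h, Function.update_self, Function.update_of_ne h'] at hde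
      omega
    · rw [h', Function.update_self, Function.update_of_ne h] at hde
      omega
    · rw [Function.update_of_ne h, Function.update_of_ne h'] at hde
      exact hT.1.2.1 (hd'.resolve_left h) (he'.resolve_left h') hde
  · rintro a ⟨ha1, ha2⟩
    rcases Nat.lt_or_ge k.card a with h | h
    · refine ⟨c, (hmem c).2 (Or.inl rfl), ?_⟩
      rw [Function.update_self]
      omega
    · obtain ⟨d, hd, rfl⟩ := hT.1.2.2 ⟨ha1, h⟩
      refine ⟨d, (hmem d).2 (Or.inr hd), Function.update_of_ne ?_ _ _⟩
      rintro rfl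
      exact hc hd
  · intro i j1 j2 hj h
    exact hlt _ _ ⟨le_rfl, hj.le⟩ (by simp [hj.ne]) h (hT.2.1 i j1 j2 hj)
  · intro i1 i2 j hi h
    exact hlt _ _ ⟨hi.le, le_rfl⟩ (by simp [hi.ne]) h (hT.2.2.1 i1 i2 j hi)
  · intro d hd
    rw [hmem, not_or] at hd
    rw [Function.update_of_ne hd.1, hT.2.2.2 d hd.2]

/-- The cell of the largest entry of a tableau can be removed. -/
theorem exists_restrict {l : YoungDiagram} {T : ℕ × ℕ → ℕ} (hT : IsSYT l T) (hl : 0 < l.card) :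
    ∃ (k : YoungDiagram) (c : ℕ × ℕ), c ∉ k.cells ∧ l.cells = insert c k.cells ∧ T c = l.card ∧
      IsSYT k (Function.update T c 0) := by
  obtain ⟨c, hc, hTc⟩ := hT.1.2.2 ⟨hl, le_refl l.card⟩
  rw [Finset.mem_coe] at hc
  have hmax (d : ℕ × ℕ) (hd : d ∈ l) (hcd : c ≤ d) : d = c := by
    obtain ⟨i, j⟩ := c
    obtain ⟨a, b⟩ := d
    obtain ⟨h1, h2⟩ : i ≤ a ∧ j ≤ b := hcd
    have hle := hT.le_card (a, b)
    have hib : T (i, j) ≤ T (i, b) := by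
      rcases h2.eq_or_lt with rfl | h2
      · rfl
      · exact (hT.2.1 i j b h2 (l.up_left_mem h1 le_rfl hd)).le
    have hab : T (i, b) ≤ T (a, b) := by
      rcases h1.eq_or_lt with rfl | h1
      · rfl
      · exact (hT.2.2.1 i a b h1 hd).le
    exact hT.1.2.1 hd hc (by omega)
  let k : YoungDiagram :=
    { cells := l.cells.erase c
      isLowerSet := by
        intro a b hba ha
        simp only [Finset.coe_erase, Set.mem_sdiff, Set.mem_singleton_iff, Finset.mem_coe] at ha ⊢
        refine ⟨l.isLowerSet hba ha.1, ?_⟩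
        rintro rfl
        exact ha.2 (hmax a ha.1 hba) }
  have hck : c ∉ k.cells := Finset.notMem_erase _ _
  have hlk : l.cells = insert c k.cells := (Finset.insert_erase hc).symm
  have hcard : l.card = k.card + 1 := by
    rw [YoungDiagram.card, hlk, Finset.card_insert_of_notMem hck]
  have hmem (d : ℕ × ℕ) : d ∈ k ↔ d ≠ c ∧ d ∈ l := by
    rw [← mem_cells, ← mem_cells]
    exact Finset.mem_erase
  have hlt (d e : ℕ × ℕ) (hde : d ≤ e) (he : e ∈ k) (h : T d < T e) :
      Function.update T c 0 d < Function.update T c 0 e := by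
    have hd := (hmem d).1 (k.isLowerSet hde he)
    rwa [Function.update_of_ne hd.1, Function.update_of_ne ((hmem e).1 he).1]
  refine ⟨k, c, hck, hlk, hTc, ⟨?_, ?_, ?_⟩, ?_, ?_, ?_⟩
  · intro d hd
    obtain ⟨h1, h2⟩ := (hmem d).1 hd
    rw [Function.update_of_ne h1]
    refine ⟨(hT.1.1 h2).1, ?_⟩
    have hle := hT.le_card d
    have hne : T d ≠ T c := fun h => h1 (hT.1.2.1 h2 hc h)
    omega
  · intro d hd e he hde
    obtain ⟨h1, h2⟩ := (hmem d).1 hd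
    obtain ⟨h3, h4⟩ := (hmem e).1 he
    rw [Function.update_of_ne h1, Function.update_of_ne h3] at hde
    exact hT.1.2.1 h2 h4 hde
  · rintro a ⟨ha1, ha2⟩
    obtain ⟨d, hd, rfl⟩ := hT.1.2.2 ⟨ha1, show a ≤ l.card by omega⟩
    have hdc : d ≠ c := by
      rintro rfl
      omega
    exact ⟨d, (hmem d).2 ⟨hdc, hd⟩, Function.update_of_ne hdc _ _⟩
  · intro i j1 j2 hj h
    exact hlt _ _ ⟨le_rfl, hj.le⟩ h (hT.2.1 i j1 j2 hj ((hmem _).1 h).2)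
  · intro i1 i2 j hi h
    exact hlt _ _ ⟨hi.le, le_rfl⟩ h (hT.2.2.1 i1 i2 j hi ((hmem _).1 h).2)
  · intro d hd
    by_cases h : d = c
    · rw [h, Function.update_self]
    · rw [Function.update_of_ne h]
      exact hT.2.2.2 d fun hdl => hd ((hmem d).2 ⟨h, hdl⟩)

theorem finite_subtype (l : YoungDiagram) : Finite {T : ℕ × ℕ → ℕ // IsSYT l T} := by
  refine Finite.of_injective
    (fun T (c : l.cells) => (⟨T.1 c, Nat.lt_succ_of_le (T.2.le_card c)⟩ : Fin (l.card + 1))) ?_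
  intro S T h
  refine Subtype.ext (funext fun c => ?_)
  by_cases hc : c ∈ l
  · exact congrArg Fin.val (congrFun h ⟨c, hc⟩)
  · rw [S.2.2.2.2 c hc, T.2.2.2.2 c hc]

end IsSYT

theorem natCard_sigma_sytCard {s : Finset YoungDiagram} {p : YoungDiagram → Prop}
    (h : ∀ l, l ∈ s ↔ p l) :
    Nat.card (Σ l : {l // p l}, {T : ℕ × ℕ → ℕ // IsSYT l.1 T}) = ∑ l ∈ s, sytCard l := by
  have := IsSYT.finite_subtype
  let _ : Fintype {l // p l} := Fintype.subtype s h
  rw [Nat.card_sigma]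
  exact (Finset.sum_subtype s h sytCard).symm

theorem sytCard_eq_sum_downCovers {l : YoungDiagram} (hl : 0 < l.card) :
    sytCard l = ∑ k ∈ l.downCovers, sytCard k := by
  rw [← natCard_sigma_sytCard (fun _ => Iff.rfl)]
  have hex (k : {k // k ∈ l.downCovers}) :
      ∃ c ∉ k.1.cells, l.cells = insert c k.1.cells :=
    exists_cells_eq_insert (mem_downCovers_iff_mem_upCovers.1 k.2)
  choose c hc hlc using hex
  have hcard (k : {k // k ∈ l.downCovers}) : k.1.card + 1 = l.card := (mem_downCovers.1 k.2).2
  symm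
  refine Nat.card_eq_of_bijective (fun x => ⟨Function.update x.2.1 (c x.1) (x.1.1.card + 1),
    x.2.2.update (hc x.1) (hlc x.1)⟩) ⟨?_, ?_⟩
  · rintro ⟨k, S, hS⟩ ⟨k', S', hS'⟩ h
    have h := congrArg Subtype.val h
    simp only at h
    have hcc : c k = c k' := by
      by_contra hne
      have h1 := congrFun h (c k)
      rw [Function.update_self, Function.update_of_ne hne] at h1
      have := hS'.le_card (c k)
      have := hcard k
      have := hcard k'
      omega
    have hk : k = k' := by
      refine Subtype.ext (YoungDiagram.ext ?_)
      rw [← Finset.erase_insert (hc k), ← Finset.erase_insert (hc k'), ← hlc, ← hlc, hcc]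
    subst hk
    have hSS : S = S' := by
      funext d
      by_cases hd : d = c k
      · have hck := hc k
        rw [mem_cells] at hck
        rw [hd, hS.2.2.2 _ hck, hS'.2.2.2 _ hck]
      · have h1 := congrFun h d
        rwa [Function.update_of_ne hd, Function.update_of_ne hd] at h1
    subst hSS
    rfl
  · rintro ⟨T, hT⟩
    obtain ⟨k, d, hd, hld, hTd, hk⟩ := hT.exists_restrict hl
    have hmem : k ∈ l.downCovers := by
      rw [mem_downCovers, ← cells_subset_iff, YoungDiagram.card, YoungDiagram.card, hld]
      exact ⟨Finset.subset_insert _ _, (Finset.card_insert_of_notMem hd).symm⟩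
    have hcd : c ⟨k, hmem⟩ = d := by
      have h1 : d ∈ insert (c ⟨k, hmem⟩) k.cells := by
        rw [← hlc ⟨k, hmem⟩, hld]
        exact Finset.mem_insert_self _ _
      exact ((Finset.mem_insert.1 h1).resolve_right hd).symm
    refine ⟨⟨⟨k, hmem⟩, _, hk⟩, Subtype.ext ?_⟩
    simp only [hcd, hcard ⟨k, hmem⟩, Function.update_idem]
    rw [← hTd, Function.update_eq_self]

theorem sum_upCovers_sytCard (n : ℕ) (l : YoungDiagram) (hl : l.card = n) :
    ∑ m ∈ l.upCovers, sytCard m = (n + 1) * sytCard l := by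
  induction n generalizing l with
  | zero =>
    have hdown : l.downCovers = ∅ := by
      refine Finset.eq_empty_of_forall_notMem fun k hk => ?_
      have := (mem_downCovers.1 hk).2
      omega
    rw [Finset.sum_congr rfl (fun m hm => sytCard_eq_sum_downCovers
      (by rw [(mem_upCovers.1 hm).2]; omega)), sum_upCovers_sum_downCovers, hdown]
    simp
  | succ n ih =>
    rw [Finset.sum_congr rfl (fun m hm => sytCard_eq_sum_downCovers
      (by rw [(mem_upCovers.1 hm).2]; omega)), sum_upCovers_sum_downCovers,
      Finset.sum_congr rfl (fun k hk => ih k (by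
        have := (mem_downCovers.1 hk).2
        omega)), ← Finset.mul_sum, ← sytCard_eq_sum_downCovers (by omega)]
    ring

/-- insertion scheme: for every `λ ⊢ n` there is a bijection
between (standard Young tableaux of shape `λ`) × `{1, …, n+1}` and the disjoint
union, over all `μ ⊢ n+1` obtained from `λ` by adding one square, of the
standard Young tableaux of shape `μ`. -/
theorem insertion_scheme_exists (n : ℕ) (l : YoungDiagram) (hl : l.card = n) :
    Nonempty
      ({T : ℕ × ℕ → ℕ // IsSYT l T} × {i : ℕ // i ∈ Finset.Icc 1 (n + 1)} ≃
        Σ m : {m : YoungDiagram // l ≤ m ∧ m.card = n + 1},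
          {T : ℕ × ℕ → ℕ // IsSYT m.1 T}) := by
  have := IsSYT.finite_subtype
  have hup (m : YoungDiagram) : m ∈ l.upCovers ↔ l ≤ m ∧ m.card = n + 1 := by
    rw [mem_upCovers, hl]
  have : Finite {m : YoungDiagram // l ≤ m ∧ m.card = n + 1} :=
    ((finite_setOf_card_eq (n + 1)).subset fun _ h => h.2).to_subtype
  refine Finite.card_eq.1 ?_
  rw [natCard_sigma_sytCard hup, sum_upCovers_sytCard n l hl, Nat.card_prod,
    Nat.card_eq_finsetCard, Nat.card_Icc, Nat.add_sub_cancel, mul_comm, sytCard]
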